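/- (Convergence of the policy costs) Suppose m_k < C for all k, let (λ*, v*) be a solution of the multiplicative Bellman optimality equation, and suppose that for each n the greedy policy f_{n+1} produced by risk-sensitive MPI admits a Perron pair (λ_{f_{n+1}}, w_{n+1}). Then lim_{n→∞} λ_{f_{n+1}} = λ*; that is, the risk-sensitive average costs of the policies generated by the algorithm converge to the optimal risk-sensitive average cost. -/

import Mathlib

open Filter Topology

/-- Bellman operator of a policy `f`. -/
noncomputable def Tpol {S A : Type*} [Fintype S]
    (Q : S → A → S → ℝ) (d : S → A → ℝ) (α : ℝ) (f : S → A) (v : S → ℝ) (i : S) : ℝ :=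
  Real.exp (α * d i (f i)) * ∑ j, Q i (f i) j * v j

/-- Bellman optimality operator. -/
noncomputable def Topt {S A : Type*} [Fintype S] [Nonempty A]
    (Q : S → A → S → ℝ) (d : S → A → ℝ) (α : ℝ) (v : S → ℝ) (i : S) : ℝ :=
  ⨅ a : A, Real.exp (α * d i a) * ∑ j, Q i a j * v j

/-- The stochastic matrix of a policy `f`: `(Q_f)(i,j) = Q(j|i,f(i))`. -/
def policyMatrix {S A : Type*} (Q : S → A → S → ℝ) (f : S → A) : Matrix S S ℝ :=
  Matrix.of fun i j => Q i (f i) j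

/-- If along each nonempty proper set of states some state outside inherits a factor `c` of a
value inside, then after `card S` steps every value dominates every initial value. -/
theorem growth_of_inheritance {S : Type*} [Fintype S] [DecidableEq S] (x : ℕ → S → ℝ) {c : ℝ}
    (hc : 0 ≤ c) (hself : ∀ r i, c * x r i ≤ x (r + 1) i)
    (hnew : ∀ r (B : Finset S), B.Nonempty → B ≠ Finset.univ →
      ∃ i ∉ B, ∃ j ∈ B, c * x r j ≤ x (r + 1) i) (i j : S) :
    c ^ Fintype.card S * x 0 j ≤ x (Fintype.card S) i := by
  have key : ∀ r, ∃ B : Finset S, j ∈ B ∧ min (r + 1) (Fintype.card S) ≤ B.card ∧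
      ∀ i ∈ B, c ^ r * x 0 j ≤ x r i := by
    intro r
    induction r with
    | zero => exact ⟨{j}, by simp, by simp, by simp⟩
    | succ r ih =>
      obtain ⟨B, hj, hcard, hB⟩ := ih
      have hstay : ∀ i ∈ B, c ^ (r + 1) * x 0 j ≤ c * x r i := fun i hi => by
        rw [pow_succ', mul_assoc]
        exact mul_le_mul_of_nonneg_left (hB i hi) hc
      by_cases hu : B = Finset.univ
      · refine ⟨B, hj, ?_, fun i hi => (hstay i hi).trans (hself r i)⟩
        rw [hu, Finset.card_univ]
        exact min_le_right _ _
      · obtain ⟨i₁, hi₁, j₁, hj₁, h⟩ := hnew r B ⟨j, hj⟩ hu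
        refine ⟨insert i₁ B, Finset.mem_insert_of_mem hj, ?_, ?_⟩
        · rw [Finset.card_insert_of_notMem hi₁]
          omega
        · intro i hi
          rcases Finset.mem_insert.1 hi with rfl | hi
          · exact (hstay j₁ hj₁).trans h
          · exact (hstay i hi).trans (hself r i)
  obtain ⟨B, -, hcard, hB⟩ := key (Fintype.card S)
  have hBu : B = Finset.univ := by
    rw [← Finset.card_eq_iff_eq_univ]
    have := B.card_le_univ
    omega
  exact hB i (hBu ▸ Finset.mem_univ i)

theorem Matrix.mulVec_mono_of_nonneg {S : Type*} [Fintype S] {M : Matrix S S ℝ}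
    (hM : ∀ i j, 0 ≤ M i j) {x y : S → ℝ} (h : ∀ i, x i ≤ y i) (i : S) :
    (M.mulVec x) i ≤ (M.mulVec y) i :=
  Finset.sum_le_sum fun j _ => mul_le_mul_of_nonneg_left (h j) (hM i j)

theorem Matrix.mul_le_mulVec_of_nonneg {S : Type*} [Fintype S] {M : Matrix S S ℝ}
    (hM : ∀ i j, 0 ≤ M i j) {x : S → ℝ} (hx : ∀ i, 0 ≤ x i) (i j : S) :
    M i j * x j ≤ (M.mulVec x) i :=
  Finset.single_le_sum (f := fun j => M i j * x j)
    (fun k _ => mul_nonneg (hM i k) (hx k)) (Finset.mem_univ j)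

theorem Matrix.pow_mulVec_nonneg {S : Type*} [Fintype S] [DecidableEq S] {M : Matrix S S ℝ}
    (hM : ∀ i j, 0 ≤ M i j) {x : S → ℝ} (hx : ∀ i, 0 ≤ x i) (m : ℕ) (i : S) :
    0 ≤ ((M ^ m).mulVec x) i := by
  induction m generalizing i with
  | zero => simpa using hx i
  | succ m ih =>
    rw [pow_succ', ← Matrix.mulVec_mulVec]
    exact Finset.sum_nonneg fun j _ => mul_nonneg (hM i j) (ih j)

theorem Matrix.pow_mul_le_pow_mulVec {S : Type*} [Fintype S] [DecidableEq S]
    {M : Matrix S S ℝ} {δ : ℝ} (hδ : 0 ≤ δ) (hM : ∀ i j, 0 ≤ M i j) {x : S → ℝ}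
    (hx : ∀ i, 0 ≤ x i) {i j : S} (hii : δ ≤ M i i) (hij : δ ≤ M i j) {m : ℕ} (hm : 1 ≤ m) :
    δ ^ m * x j ≤ ((M ^ m).mulVec x) i := by
  induction m, hm using Nat.le_induction with
  | base =>
    rw [pow_one, pow_one]
    exact (mul_le_mul_of_nonneg_right hij (hx j)).trans (M.mul_le_mulVec_of_nonneg hM hx i j)
  | succ m _ ih =>
    rw [pow_succ', pow_succ', ← Matrix.mulVec_mulVec, mul_assoc]
    exact (mul_le_mul hii ih (mul_nonneg (pow_nonneg hδ m) (hx j)) (hM i i)).trans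
      (M.mul_le_mulVec_of_nonneg hM (Matrix.pow_mulVec_nonneg hM hx m) i i)

theorem Matrix.pow_mulVec_le {S : Type*} [Fintype S] [DecidableEq S]
    {M : Matrix S S ℝ} {β : ℝ} (hβ : 0 ≤ β) (hM : ∀ i j, 0 ≤ M i j) {x : S → ℝ}
    (h : ∀ i, (M.mulVec x) i ≤ β * x i) (m : ℕ) (i : S) :
    ((M ^ m).mulVec x) i ≤ β ^ m * x i := by
  induction m generalizing i with
  | zero => simp
  | succ m ih =>
    rw [pow_succ', ← Matrix.mulVec_mulVec]
    calc (M.mulVec ((M ^ m).mulVec x)) i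
        ≤ (M.mulVec (β ^ m • x)) i := M.mulVec_mono_of_nonneg hM ih i
      _ = β ^ m * (M.mulVec x) i := by rw [Matrix.mulVec_smul]; rfl
      _ ≤ β ^ m * (β * x i) := mul_le_mul_of_nonneg_left (h i) (pow_nonneg hβ m)
      _ = β ^ (m + 1) * x i := by ring

/-- Collatz-Wielandt comparison of a subeigenvalue with a supereigenvalue. -/
theorem Matrix.subeigenvalue_le_supereigenvalue {S : Type*} [Fintype S] [Nonempty S]
    {M : Matrix S S ℝ} (hM : ∀ i j, 0 ≤ M i j) {v w : S → ℝ} (hv : ∀ i, 0 < v i)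
    (hw : ∀ i, 0 < w i) {a b : ℝ} (ha : ∀ i, a * v i ≤ (M.mulVec v) i)
    (hb : ∀ i, (M.mulVec w) i ≤ b * w i) : a ≤ b := by
  obtain ⟨i, hi⟩ := Finite.exists_max fun i => v i / w i
  have hvw : ∀ j, v j ≤ (v i / w i) * w j := fun j => (div_le_iff₀ (hw j)).1 (hi j)
  refine le_of_mul_le_mul_right ?_ (hv i)
  calc a * v i ≤ (M.mulVec v) i := ha i
    _ ≤ (M.mulVec ((v i / w i) • w)) i := M.mulVec_mono_of_nonneg hM hvw i
    _ = (v i / w i) * (M.mulVec w) i := by rw [Matrix.mulVec_smul]; rfl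
    _ ≤ (v i / w i) * (b * w i) :=
        mul_le_mul_of_nonneg_left (hb i) (div_pos (hv i) (hw i)).le
    _ = b * v i := by field_simp [(hw i).ne']

theorem Matrix.exists_pos_entry_of_irreducible {S : Type*} [Fintype S] [DecidableEq S]
    {M : Matrix S S ℝ} (hM : ∀ i j, 0 ≤ M i j) (hirr : ∀ i j, ∃ k : ℕ, 1 ≤ k ∧ 0 < (M ^ k) i j)
    (B : Finset S) (hne : B.Nonempty) (hB : B ≠ Finset.univ) :
    ∃ i ∉ B, ∃ j ∈ B, 0 < M i j := by
  by_contra! hcon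
  have hzero : ∀ k : ℕ, ∀ i ∉ B, ∀ j ∈ B, (M ^ k) i j = 0 := by
    intro k
    induction k with
    | zero =>
      intro i hi j hj
      rw [pow_zero, Matrix.one_apply_ne]
      rintro rfl
      exact hi hj
    | succ k ih =>
      intro i hi j hj
      rw [pow_succ', Matrix.mul_apply]
      refine Finset.sum_eq_zero fun l _ => ?_
      by_cases hl : l ∈ B
      · rw [le_antisymm (hcon i hi l hl) (hM i l), zero_mul]
      · rw [ih l hl j hj, mul_zero]
  obtain ⟨j, hj⟩ := hne
  obtain ⟨i, hi⟩ : ∃ i, i ∉ B := by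
    by_contra! h
    exact hB (Finset.eq_univ_of_forall h)
  obtain ⟨k, -, hk⟩ := hirr i j
  exact hk.ne' (hzero k i hi j hj)

/-- Normalized products of uniformly connected nonnegative matrices, each step improving on the
previous matrix, have Collatz-Wielandt bounds whose gap tends to zero. -/
theorem exists_collatz_wielandt_bounds_tendsto {S : Type*} [Fintype S] [Nonempty S]
    [DecidableEq S] (P : ℕ → Matrix S S ℝ) {δ : ℝ} (hδ : 0 < δ) (hP : ∀ n i j, 0 ≤ P n i j)
    (hdiag : ∀ n i, δ ≤ P n i i)
    (hconn : ∀ n (B : Finset S), B.Nonempty → B ≠ Finset.univ →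
      ∃ i ∉ B, ∃ j ∈ B, δ ≤ P n i j)
    (m : ℕ → ℕ) (hm : ∀ n, 1 ≤ m n) (C : ℕ) (hC : ∀ n, m n ≤ C)
    (v : ℕ → S → ℝ) (hv : ∀ n i, 0 < v n i) (hsum : ∀ n, ∑ i, v n i = 1)
    (hstep : ∀ n, v (n + 1) =
      (∑ j, ((P n ^ m n).mulVec (v n)) j)⁻¹ • (P n ^ m n).mulVec (v n))
    (himp : ∀ n i, ((P (n + 1)).mulVec (v (n + 1))) i ≤ ((P n).mulVec (v (n + 1))) i) :
    ∃ a b : ℕ → ℝ, (∀ n i, a n * v n i ≤ ((P n).mulVec (v n)) i) ∧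
      (∀ n i, ((P n).mulVec (v n)) i ≤ b n * v n i) ∧
      Tendsto (fun n => b n - a n) atTop (𝓝 0) := by
  choose imax himax using fun n =>
    Finite.exists_max fun i => ((P n).mulVec (v n)) i / v n i
  set b : ℕ → ℝ := fun n => ((P n).mulVec (v n)) (imax n) / v n (imax n) with hb
  have hbv : ∀ n i, ((P n).mulVec (v n)) i ≤ b n * v n i := fun n i =>
    (div_le_iff₀ (hv n i)).1 (himax n i)
  have hb_le : ∀ n c, (∀ i, ((P n).mulVec (v n)) i ≤ c * v n i) → b n ≤ c := fun n c h =>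
    (div_le_iff₀ (hv n _)).2 (h _)
  have hδb : ∀ n, δ ≤ b n := fun n => by
    let i := imax n
    refine le_of_mul_le_mul_right ?_ (hv n i)
    exact (mul_le_mul_of_nonneg_right (hdiag n i) (hv n i).le).trans
      (((P n).mul_le_mulVec_of_nonneg (hP n) (fun i => (hv n i).le) i i).trans (hbv n i))
  have hs : ∀ n, 0 < ∑ j, ((P n ^ m n).mulVec (v n)) j := fun n =>
    Finset.sum_pos (fun j _ => (mul_pos (pow_pos hδ _) (hv n j)).trans_le
      (Matrix.pow_mul_le_pow_mulVec hδ.le (hP n) (fun i => (hv n i).le) (hdiag n j) (hdiag n j)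
        (hm n))) Finset.univ_nonempty
  -- The slack of a bound `c` is transported by the normalized step.
  have hslack : ∀ n c i, (∑ j, ((P n ^ m n).mulVec (v n)) j)⁻¹ *
      ((P n ^ m n).mulVec (c • v n - (P n).mulVec (v n))) i ≤
        c * v (n + 1) i - ((P (n + 1)).mulVec (v (n + 1))) i := by
    intro n c i
    refine le_trans (le_of_eq ?_) (sub_le_sub_left (himp n i) _)
    rw [hstep n, Matrix.mulVec_sub, Matrix.mulVec_smul, Matrix.mulVec_smul,
      Matrix.mulVec_mulVec, Matrix.mulVec_mulVec, ← pow_succ, ← pow_succ']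
    simp only [Pi.sub_apply, Pi.smul_apply, smul_eq_mul]
    ring
  have hanti : Antitone b := antitone_nat_of_succ_le fun n => hb_le _ _ fun i => by
    have h := hslack n (b n) i
    have h' : 0 ≤ ((P n ^ m n).mulVec (b n • v n - (P n).mulVec (v n))) i :=
      Matrix.pow_mulVec_nonneg (hP n) (fun j => sub_nonneg.2 (hbv n j)) _ _
    linarith [mul_nonneg (inv_nonneg.2 (hs n).le) h']
  have hb0 : 0 < b 0 := hδ.trans_le (hδb 0)
  have hbv0 : ∀ n i, ((P n).mulVec (v n)) i ≤ b 0 * v n i := fun n i =>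
    (hbv n i).trans (mul_le_mul_of_nonneg_right (hanti (Nat.zero_le n)) (hv n i).le)
  set ρ : ℝ := δ / b 0 with hρ
  have hρ0 : 0 < ρ := div_pos hδ hb0
  have hρ1 : ρ ≤ 1 := (div_le_one hb0).2 (hδb 0)
  set N := Fintype.card S with hN
  have hNpos : (0 : ℝ) < N := by exact_mod_cast Fintype.card_pos
  have hlow : ∀ n j, ρ ^ N / N ≤ v n j := by
    intro n j
    have hle : ∀ i k, δ ≤ P n i k → ρ * v n k ≤ v n i := fun i k hik => by
      rw [hρ, div_mul_eq_mul_div, div_le_iff₀ hb0, mul_comm (v n i)]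
      exact (mul_le_mul_of_nonneg_right hik (hv n k).le).trans
        (((P n).mul_le_mulVec_of_nonneg (hP n) (fun i => (hv n i).le) i k).trans (hbv0 n i))
    have hall : ∀ i, ρ ^ N * v n i ≤ v n j := fun i =>
      growth_of_inheritance (fun _ => v n) hρ0.le (fun _ i => hle i i (hdiag n i))
        (fun _ B h₁ h₂ => by
          obtain ⟨i, hi, k, hk, hik⟩ := hconn n B h₁ h₂
          exact ⟨i, hi, k, hk, hle i k hik⟩) j i
    have := Finset.sum_le_sum fun i (_ : i ∈ Finset.univ) => hall i
    rw [← Finset.mul_sum, hsum, Finset.sum_const, Finset.card_univ, nsmul_eq_mul] at this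
    rw [div_le_iff₀ hNpos]
    linarith
  set ε : ℝ := ρ ^ N / N with hε
  have hε0 : 0 < ε := div_pos (pow_pos hρ0 N) hNpos
  set c : ℝ := ρ ^ C with hc
  have hc0 : 0 < c := pow_pos hρ0 C
  have htrans : ∀ n k i j, k ≤ n → δ ≤ P n i j →
      c * (b k * v n j - ((P n).mulVec (v n)) j) ≤
        b k * v (n + 1) i - ((P (n + 1)).mulVec (v (n + 1))) i := by
    intro n k i j hkn hij
    have hx : ∀ l, 0 ≤ (b k • v n - (P n).mulVec (v n)) l := fun l =>
      sub_nonneg.2 ((hbv n l).trans (mul_le_mul_of_nonneg_right (hanti hkn) (hv n l).le))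
    refine le_trans ?_ (hslack n (b k) i)
    have hs_le : ∑ l, ((P n ^ m n).mulVec (v n)) l ≤ b 0 ^ m n := by
      refine (Finset.sum_le_sum fun l _ =>
        Matrix.pow_mulVec_le hb0.le (hP n) (hbv0 n) (m n) l).trans ?_
      rw [← Finset.mul_sum, hsum, mul_one]
    have hpow := Matrix.pow_mul_le_pow_mulVec hδ.le (hP n) hx (hdiag n i) hij (hm n)
    calc c * (b k * v n j - ((P n).mulVec (v n)) j)
        ≤ ρ ^ m n * (b k * v n j - ((P n).mulVec (v n)) j) :=
          mul_le_mul_of_nonneg_right (pow_le_pow_of_le_one hρ0.le hρ1 (hC n)) (hx j)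
      _ = (b 0 ^ m n)⁻¹ * (δ ^ m n * (b k * v n j - ((P n).mulVec (v n)) j)) := by
          rw [hρ, div_pow]
          ring
      _ ≤ _ := mul_le_mul (inv_anti₀ (hs n) hs_le) hpow
          (mul_nonneg (pow_nonneg hδ.le _) (hx j)) (inv_nonneg.2 (hs n).le)
  have hdrop : ∀ n j, c ^ N * (b n * v n j - ((P n).mulVec (v n)) j) ≤ b n - b (n + N) := by
    intro n j
    have hx0 : 0 ≤ c ^ N * (b n * v n j - ((P n).mulVec (v n)) j) :=
      mul_nonneg (pow_nonneg hc0.le N) (sub_nonneg.2 (hbv n j))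
    have hg := fun i => growth_of_inheritance
      (fun r i => b n * v (n + r) i - ((P (n + r)).mulVec (v (n + r))) i) hc0.le
      (fun r i => htrans (n + r) n i i (Nat.le_add_right _ _) (hdiag _ i))
      (fun r B h₁ h₂ => by
        obtain ⟨i, hi, k, hk, hik⟩ := hconn (n + r) B h₁ h₂
        exact ⟨i, hi, k, hk, htrans (n + r) n i k (Nat.le_add_right _ _) hik⟩) i j
    have := hb_le (n + N) (b n - c ^ N * (b n * v n j - ((P n).mulVec (v n)) j)) fun i => by
      have hv1 : v (n + N) i ≤ 1 := by
        rw [← hsum (n + N)]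
        exact Finset.single_le_sum (f := v (n + N)) (fun l _ => (hv _ l).le) (Finset.mem_univ i)
      have h := hg i
      simp only [add_zero] at h
      rw [sub_mul]
      linarith [mul_le_of_le_one_right hx0 hv1]
    linarith
  refine ⟨fun n => b n - (c ^ N * ε)⁻¹ * (b n - b (n + N)), b, fun n i => ?_, hbv, ?_⟩
  · have hcN : 0 < c ^ N * ε := mul_pos (pow_pos hc0 N) hε0
    have hd := hdrop n i
    have hbb : 0 ≤ b n - b (n + N) := sub_nonneg.2 (hanti (Nat.le_add_right n N))
    have h1 : b n * v n i - ((P n).mulVec (v n)) i ≤ (c ^ N)⁻¹ * (b n - b (n + N)) := by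
      rw [inv_mul_eq_div, le_div_iff₀ (pow_pos hc0 N), mul_comm]
      exact hd
    have h2 : (c ^ N)⁻¹ * (b n - b (n + N)) =
        (c ^ N * ε)⁻¹ * (b n - b (n + N)) * ε := by
      field_simp
    have h3 := mul_le_mul_of_nonneg_left (hlow n i)
      (mul_nonneg (inv_nonneg.2 hcN.le) hbb)
    rw [sub_mul]
    linarith
  · have hlim : Tendsto b atTop (𝓝 (⨅ n, b n)) :=
      tendsto_atTop_ciInf hanti ⟨δ, by rintro _ ⟨n, rfl⟩; exact hδb n⟩
    have hlim' := hlim.comp (tendsto_add_atTop_nat N)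
    have := (hlim.sub hlim').const_mul (c ^ N * ε)⁻¹
    simpa using this

/-- The exponentially weighted transition matrix of a policy. -/
noncomputable def weightedMatrix {S A : Type*} (Q : S → A → S → ℝ) (d : S → A → ℝ) (α : ℝ)
    (f : S → A) : Matrix S S ℝ :=
  Matrix.of fun i j => Real.exp (α * d i (f i)) * Q i (f i) j

theorem weightedMatrix_mulVec {S A : Type*} [Fintype S] (Q : S → A → S → ℝ) (d : S → A → ℝ)
    (α : ℝ) (f : S → A) (v : S → ℝ) :
    (weightedMatrix Q d α f).mulVec v = Tpol Q d α f v := by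
  ext i
  simp [weightedMatrix, Matrix.mulVec, dotProduct, Tpol, Finset.mul_sum, mul_assoc]

theorem weightedMatrix_pow_mulVec {S A : Type*} [Fintype S] [DecidableEq S]
    (Q : S → A → S → ℝ) (d : S → A → ℝ) (α : ℝ) (f : S → A) (v : S → ℝ) (m : ℕ) :
    (weightedMatrix Q d α f ^ m).mulVec v = (Tpol Q d α f)^[m] v := by
  induction m with
  | zero => simp
  | succ m ih =>
    rw [pow_succ', ← Matrix.mulVec_mulVec, ih, weightedMatrix_mulVec, Function.iterate_succ_apply']

theorem Topt_le_Tpol {S A : Type*} [Fintype S] [Finite A] [Nonempty A]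
    (Q : S → A → S → ℝ) (d : S → A → ℝ) (α : ℝ) (f : S → A) (v : S → ℝ) (i : S) :
    Topt Q d α v i ≤ Tpol Q d α f v i :=
  ciInf_le (Set.finite_range _).bddBelow (f i)

theorem exists_Tpol_eq_Topt {S A : Type*} [Fintype S] [Finite A] [Nonempty A]
    (Q : S → A → S → ℝ) (d : S → A → ℝ) (α : ℝ) (v : S → ℝ) :
    ∃ f : S → A, ∀ i, Tpol Q d α f v i = Topt Q d α v i := by
  choose f hf using fun i => exists_eq_ciInf_of_finite
    (f := fun a : A => Real.exp (α * d i a) * ∑ j, Q i a j * v j)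
  exact ⟨f, hf⟩

/-- Convergence of the policy costs: if `m_k < C` for all `k`, `(λ*, v*)` solves the
multiplicative Bellman optimality equation, and each greedy policy `f_{n+1}` produced by
risk-sensitive MPI admits a Perron pair `(λ_{f_{n+1}}, w_{n+1})`, then
`λ_{f_{n+1}} → λ*`. -/
theorem mpi_policy_costs_converge
    {S A : Type*} [Fintype S] [Fintype A] [Nonempty S] [Nonempty A] [DecidableEq S]
    (Q : S → A → S → ℝ) (d : S → A → ℝ) (α : ℝ) (hα : 0 < α)
    (hQ0 : ∀ i a j, 0 ≤ Q i a j) (hQ1 : ∀ i a, ∑ j, Q i a j = 1)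
    (hdiag : ∀ i a, 0 < Q i a i)
    (hirr : ∀ f : S → A, ∀ i j : S, ∃ k : ℕ, 1 ≤ k ∧ 0 < ((policyMatrix Q f) ^ k) i j)
    (m : ℕ → ℕ) (hm : ∀ k, 1 ≤ m k) (C : ℕ) (hC : ∀ k, m k < C)
    (lamStar : ℝ) (vStar : S → ℝ)
    (hlamStar : 0 < lamStar) (hvStar : ∀ i, 0 < vStar i)
    (hopt : ∀ i, lamStar * vStar i = Topt Q d α vStar i)
    (v' : ℕ → S → ℝ) (f : ℕ → S → A)
    (hv0pos : ∀ i, 0 < v' 0 i) (hv0sum : ∑ i, v' 0 i = 1)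
    (hgreedy : ∀ k i, Tpol Q d α (f (k + 1)) (v' k) i = Topt Q d α (v' k) i)
    (hstep : ∀ k i, v' (k + 1) i =
      (Tpol Q d α (f (k + 1)))^[m k] (v' k) i /
        ∑ j, (Tpol Q d α (f (k + 1)))^[m k] (v' k) j)
    (lamF : ℕ → ℝ) (w : ℕ → S → ℝ)
    (hPerron : ∀ n : ℕ, 0 < lamF n ∧ (∀ i, 0 < w n i) ∧
      ∀ i, ∑ j, (Real.exp (α * d i (f (n + 1) i)) * Q i (f (n + 1) i) j) * w n j =
        lamF n * w n i) :
    Tendsto lamF atTop (𝓝 lamStar) := by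
  classical
  set P : ℕ → Matrix S S ℝ := fun n => weightedMatrix Q d α (f (n + 1)) with hPdef
  have hW : ∀ g : S → A, ∀ i j, 0 ≤ weightedMatrix Q d α g i j := fun g i j =>
    mul_nonneg (Real.exp_pos _).le (hQ0 i (g i) j)
  obtain ⟨δ, hδ, hδle⟩ : ∃ δ : ℝ, 0 < δ ∧
      ∀ i a j, 0 < Q i a j → δ ≤ Real.exp (α * d i a) * Q i a j := by
    obtain ⟨p, hp⟩ := Finite.exists_min fun p : S × A × S =>
      if 0 < Q p.1 p.2.1 p.2.2 then Real.exp (α * d p.1 p.2.1) * Q p.1 p.2.1 p.2.2 else 1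
    refine ⟨_, ?_, fun i a j h => (hp (i, a, j)).trans_eq (if_pos h)⟩
    split_ifs with h
    · exact mul_pos (Real.exp_pos _) h
    · exact one_pos
  have hit : ∀ n, (Tpol Q d α (f (n + 1)))^[m n] (v' n) = (P n ^ m n).mulVec (v' n) :=
    fun n => (weightedMatrix_pow_mulVec Q d α (f (n + 1)) (v' n) (m n)).symm
  have hdiagP : ∀ n i, δ ≤ P n i i := fun n i => hδle _ _ _ (hdiag i _)
  have hvs : ∀ n, (∀ i, 0 < v' n i) ∧ ∑ i, v' n i = 1 := by
    intro n
    induction n with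
    | zero => exact ⟨hv0pos, hv0sum⟩
    | succ n ih =>
      have hpos : ∀ i, 0 < ((P n ^ m n).mulVec (v' n)) i := fun i =>
        (mul_pos (pow_pos hδ _) (ih.1 i)).trans_le
          (Matrix.pow_mul_le_pow_mulVec hδ.le (hW _) (fun i => (ih.1 i).le) (hdiagP n i)
            (hdiagP n i) (hm n))
      have hspos : 0 < ∑ j, ((P n ^ m n).mulVec (v' n)) j :=
        Finset.sum_pos (fun i _ => hpos i) Finset.univ_nonempty
      simp only [hstep n, hit n]
      refine ⟨fun i => div_pos (hpos i) hspos, ?_⟩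
      rw [← Finset.sum_div, div_self hspos.ne']
  obtain ⟨a, b, ha, hb, hab⟩ := exists_collatz_wielandt_bounds_tendsto P hδ (fun n => hW _)
    hdiagP
    (fun n B h₁ h₂ => by
      obtain ⟨i, hi, j, hj, hij⟩ := Matrix.exists_pos_entry_of_irreducible
        (M := policyMatrix Q (f (n + 1))) (fun i j => hQ0 _ _ _) (hirr (f (n + 1))) B h₁ h₂
      exact ⟨i, hi, j, hj, hδle _ _ _ hij⟩)
    m hm C (fun n => (hC n).le) v' (fun n => (hvs n).1) (fun n => (hvs n).2)
    (fun n => by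
      ext i
      rw [hstep n i, hit n, Pi.smul_apply, smul_eq_mul, inv_mul_eq_div])
    (fun n i => by
      simp only [hPdef, weightedMatrix_mulVec]
      rw [hgreedy (n + 1) i]
      exact Topt_le_Tpol Q d α _ _ i)
  have hPw : ∀ n i, ((P n).mulVec (w n)) i = lamF n * w n i := fun n => (hPerron n).2.2
  obtain ⟨g, hg⟩ := exists_Tpol_eq_Topt Q d α vStar
  have hF : ∀ n, a n ≤ lamF n ∧ lamF n ≤ b n := fun n =>
    ⟨Matrix.subeigenvalue_le_supereigenvalue (hW _) (hvs n).1 (hPerron n).2.1 (ha n)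
        fun i => (hPw n i).le,
      Matrix.subeigenvalue_le_supereigenvalue (hW _) (hPerron n).2.1 (hvs n).1
        (fun i => (hPw n i).ge) (hb n)⟩
  have hStar : ∀ n, a n ≤ lamStar ∧ lamStar ≤ b n := by
    intro n
    constructor
    · refine Matrix.subeigenvalue_le_supereigenvalue (hW g) (hvs n).1 hvStar
        (fun i => (ha n i).trans ?_) fun i => ?_
      · simp only [hPdef, weightedMatrix_mulVec]
        rw [hgreedy n i]
        exact Topt_le_Tpol Q d α g _ i
      · rw [weightedMatrix_mulVec, hg, hopt]
    · refine Matrix.subeigenvalue_le_supereigenvalue (hW (f (n + 1))) hvStar (hvs n).1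
        (fun i => ?_) (hb n)
      rw [weightedMatrix_mulVec, hopt]
      exact Topt_le_Tpol Q d α _ _ i
  rw [tendsto_iff_dist_tendsto_zero]
  refine squeeze_zero (fun _ => dist_nonneg) (fun n => ?_) hab
  rw [Real.dist_eq, abs_le]
  constructor <;> linarith [(hF n).1, (hF n).2, (hStar n).1, (hStar n).2]
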